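/- Let (i_1,…,i_ν) be a reduced word of w₀ and let H∈𝒰(K_+) satisfy χ_{w₀}(H) = 1, the identity (empty product) of 𝔘₁. Then there is a descent chain H=H_1,H_2,…,H_{ν+1} for H along (i_1,…,i_ν) with tuple (c_1,…,c_ν)∈K_+^ν such that H_{ν+1} = i_1^0 i_2^0 ⋯ i_ν^0 and moreover c_k > 0 and χ_{w₀}(H_{k+1}) = g_{i_k} g_{i_{k−1}} ⋯ g_{i_1} for every k∈{1,…,ν}. -/

import Mathlib

open FreeMonoid

/-- The minimum of two elements of an additive subgroup of `ℝ`
(the "sum" in the tropical semifield `K`). -/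
noncomputable def kmin {K : AddSubgroup ℝ} (a b : K) : K :=
  if (a : ℝ) ≤ (b : ℝ) then a else b

/-- Defining relations of the monoid `𝔘(K)` attached to a simply laced Coxeter matrix `M`
and the tropical semifield `K` (a subgroup of `(ℝ, +)` with sum `min` and product `+`). -/
inductive UKRel {I : Type*} (M : CoxeterMatrix I) (K : AddSubgroup ℝ) :
    FreeMonoid (I × K) → FreeMonoid (I × K) → Prop
  | comm (i j : I) (h : M i j = 2) (a b : K) :
      UKRel M K (of (i, a) * of (j, b)) (of (j, b) * of (i, a))
  | braid (i j : I) (h : M i j = 3) (a b c : K) :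
      UKRel M K (of (i, a) * of (j, b) * of (i, c))
        (of (j, b + c - kmin a c) * of (i, kmin a c) * of (j, a + b - kmin a c))
  | idem (i : I) (a b : K) :
      UKRel M K (of (i, a) * of (i, b)) (of (i, kmin a b))

/-- The monoid `𝔘(K)`. -/
noncomputable def UK {I : Type*} (M : CoxeterMatrix I) (K : AddSubgroup ℝ) :=
  (conGen (UKRel M K)).Quotient

noncomputable instance {I : Type*} (M : CoxeterMatrix I) (K : AddSubgroup ℝ) :
    Monoid (UK M K) := Con.monoid _

/-- The generator `i^a` of `𝔘(K)`. -/
noncomputable def genU {I : Type*} (M : CoxeterMatrix I) (K : AddSubgroup ℝ)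
    (i : I) (a : K) : UK M K :=
  (Con.mk' _) (of (i, a))

/-- The product `i₁^{a₁} ⋯ i_n^{a_n}` in `𝔘(K)` associated to a list of pairs. -/
noncomputable def prodU {I : Type*} (M : CoxeterMatrix I) (K : AddSubgroup ℝ)
    (ω : List (I × K)) : UK M K :=
  (ω.map fun p => genU M K p.1 p.2).prod

/-- `l` is a reduced word of `w`. -/
def IsRedWord {I W : Type*} [Group W] {M : CoxeterMatrix I} (cs : CoxeterSystem M W)
    (w : W) (l : List I) : Prop :=
  cs.wordProd l = w ∧ l.length = cs.length w

/-- The set `𝒰(K) = 𝔘_{w₀}(K)` of products over reduced words of `w₀`. -/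
noncomputable def calU {I W : Type*} [Group W] (M : CoxeterMatrix I) (K : AddSubgroup ℝ)
    (cs : CoxeterSystem M W) (w₀ : W) : Set (UK M K) :=
  {u | ∃ ω : List (I × K), IsRedWord cs w₀ (ω.map Prod.fst) ∧ u = prodU M K ω}

/-- The set `𝒰(K₊)`: products over reduced words of `w₀` with coefficients in `K₊ = K ∩ ℝ≥0`. -/
noncomputable def calUplus {I W : Type*} [Group W] (M : CoxeterMatrix I) (K : AddSubgroup ℝ)
    (cs : CoxeterSystem M W) (w₀ : W) : Set (UK M K) :=
  {u | ∃ ω : List (I × K), IsRedWord cs w₀ (ω.map Prod.fst) ∧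
        (∀ p ∈ ω, 0 ≤ (p.2 : ℝ)) ∧ u = prodU M K ω}

/-- Two vertices of the graph on `𝒰(K)` are joined by an edge. -/
noncomputable def UEdge {I W : Type*} [Group W] (M : CoxeterMatrix I) (K : AddSubgroup ℝ)
    (cs : CoxeterSystem M W) (w₀ : W) (H H' : UK M K) : Prop :=
  H ≠ H' ∧ ∃ (i : I) (b b' : K) (ω : List (I × K)),
    IsRedWord cs w₀ (i :: ω.map Prod.fst) ∧
    H = genU M K i b * prodU M K ω ∧ H' = genU M K i b' * prodU M K ω

/-- `H` and `H'` are at distance `≤ k` in the graph on `𝒰(K)`. -/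
noncomputable def DistLE {I W : Type*} [Group W] (M : CoxeterMatrix I) (K : AddSubgroup ℝ)
    (cs : CoxeterSystem M W) (w₀ : W) (k : ℕ) (H H' : UK M K) : Prop :=
  ∃ f : ℕ → UK M K, f 0 = H ∧ f k = H' ∧ (∀ t ≤ k, f t ∈ calU M K cs w₀) ∧
    ∀ t < k, f t = f (t + 1) ∨ UEdge M K cs w₀ (f t) (f (t + 1))

/-- A descent chain for `H ∈ 𝒰(K₊)` along a reduced word `l` of `w₀`: a sequence
`H = Hs 0, Hs 1, …, Hs l.length` in `𝒰(K₊)` together with a tuple `c` in `K₊` such that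
at each step `k`, for some reduced word of `w₀` beginning with `l.get k` and some
coefficients in `K₊`, `Hs k = (l.get k)^{c k} · j₂^{a₂} ⋯ j_ν^{a_ν}` and
`Hs (k+1) = (l.get k)^{0} · j₂^{a₂} ⋯ j_ν^{a_ν}`. -/
noncomputable def DescentChain {I W : Type*} [Group W] (M : CoxeterMatrix I)
    (K : AddSubgroup ℝ) (cs : CoxeterSystem M W) (w₀ : W)
    (l : List I) (H : UK M K) (Hs : ℕ → UK M K) (c : ℕ → K) : Prop :=
  Hs 0 = H ∧
  (∀ k ≤ l.length, Hs k ∈ calUplus M K cs w₀) ∧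
  (∀ k < l.length, 0 ≤ (c k : ℝ)) ∧
  ∀ (k : ℕ) (hk : k < l.length), ∃ ω : List (I × K),
    (∀ p ∈ ω, 0 ≤ (p.2 : ℝ)) ∧
    IsRedWord cs w₀ (l.get ⟨k, hk⟩ :: ω.map Prod.fst) ∧
    Hs k = genU M K (l.get ⟨k, hk⟩) (c k) * prodU M K ω ∧
    Hs (k + 1) = genU M K (l.get ⟨k, hk⟩) 0 * prodU M K ω

/-- Defining relations of the 0-Hecke monoid `𝔘₁` of a simply laced Coxeter matrix. -/
inductive HeckeRel {I : Type*} (M : CoxeterMatrix I) : FreeMonoid I → FreeMonoid I → Prop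
  | comm (i j : I) (h : M i j = 2) : HeckeRel M (of i * of j) (of j * of i)
  | braid (i j : I) (h : M i j = 3) : HeckeRel M (of i * of j * of i) (of j * of i * of j)
  | idem (i : I) : HeckeRel M (of i * of i) (of i)

/-- The 0-Hecke monoid `𝔘₁ = 𝔘({1})`. -/
def Hecke {I : Type*} (M : CoxeterMatrix I) := (conGen (HeckeRel M)).Quotient

instance {I : Type*} (M : CoxeterMatrix I) : Monoid (Hecke M) := Con.monoid _

/-- The generator `g_i` of the 0-Hecke monoid. -/
def genH {I : Type*} (M : CoxeterMatrix I) (i : I) : Hecke M := (Con.mk' _) (of i)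

/-- The product `g_{i₁} g_{i₂} ⋯ g_{i_n}` in the 0-Hecke monoid. -/
def prodH {I : Type*} (M : CoxeterMatrix I) (l : List I) : Hecke M :=
  (l.map fun i => genH M i).prod

/-- The list of indices (in order) whose coefficient vanishes, in a word in the
generators of `𝔘(K)`. -/
noncomputable def zeroList {I : Type*} {K : AddSubgroup ℝ} : List (I × K) → List I
  | [] => []
  | p :: rest => if (p.2 : ℝ) = 0 then p.1 :: zeroList rest else zeroList rest

/-- The zero-subword of a representation `i₁^{a₁} ⋯ i_n^{a_n}`, as an element of the
0-Hecke monoid `𝔘₁`: the product `g_{i_{j₁}} ⋯ g_{i_{j_k}}` over the positions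
`j₁ < ⋯ < j_k` where `a_j = 0`. -/
noncomputable def chiRep {I : Type*} (M : CoxeterMatrix I) {K : AddSubgroup ℝ}
    (ω : List (I × K)) : Hecke M :=
  prodH M (zeroList ω)

section CoxeterExchange

variable {I W : Type*} [Group W] {M : CoxeterMatrix I}

/-- A simply laced Coxeter matrix: all off-diagonal entries are `2` or `3`. -/
def CoxeterMatrix.IsSimplyLaced (M : CoxeterMatrix I) : Prop :=
  ∀ i j : I, i ≠ j → M i j = 2 ∨ M i j = 3

theorem CoxeterSystem.simple_comm (cs : CoxeterSystem M W) {i j : I} (h : M i j = 2) :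
    cs.simple i * cs.simple j = cs.simple j * cs.simple i := by
  have h1 := cs.simple_mul_simple_pow i j
  rw [h, pow_two] at h1
  rw [eq_inv_of_mul_eq_one_left h1]
  simp

theorem CoxeterSystem.simple_braid (cs : CoxeterSystem M W) {i j : I} (h : M i j = 3) :
    cs.simple i * cs.simple j * cs.simple i = cs.simple j * cs.simple i * cs.simple j := by
  have h1 := cs.simple_mul_simple_pow i j
  rw [h, pow_three] at h1
  have h2 : (cs.simple i * cs.simple j * cs.simple i) *
      (cs.simple j * cs.simple i * cs.simple j) = 1 := by
    simpa only [mul_assoc] using h1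
  rw [eq_inv_of_mul_eq_one_left h2]
  simp [mul_assoc]

/-- If `f` sends the simple generators of a simply laced Coxeter system to involutions satisfying
the braid relations, then `f` respects all Coxeter relations. -/
theorem CoxeterMatrix.IsSimplyLaced.isLiftable (hM : M.IsSimplyLaced) {G : Type*} [Monoid G]
    (f : I → G) (h1 : ∀ i, f i * f i = 1)
    (h2 : ∀ i j, M i j = 2 → f i * f j = f j * f i)
    (h3 : ∀ i j, M i j = 3 → f i * f j * f i = f j * f i * f j) : M.IsLiftable f := by
  intro i j
  rcases eq_or_ne i j with rfl | hij
  · simp [h1]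
  · rcases hM i j hij with h | h
    · rw [h, pow_two, mul_assoc, ← mul_assoc (f j), ← h2 i j h, mul_assoc (f i), h1, mul_one, h1]
    · rw [h, pow_three]
      calc f i * f j * (f i * f j * (f i * f j))
          = f i * f j * f i * (f j * f i * f j) := by simp only [mul_assoc]
        _ = f j * f i * (f j * f j) * f i * f j := by rw [h3 i j h]; simp only [mul_assoc]
        _ = f j * (f i * f i) * f j := by rw [h1]; simp only [mul_assoc, mul_one]
        _ = 1 := by rw [h1, mul_one, h1]

theorem CoxeterMatrix.IsSimplyLaced.isLiftable_end (hM : M.IsSimplyLaced) {X : Type*}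
    (f : I → X → X) (h1 : ∀ i x, f i (f i x) = x)
    (h2 : ∀ i j, M i j = 2 → ∀ x, f i (f j x) = f j (f i x))
    (h3 : ∀ i j, M i j = 3 → ∀ x, f i (f j (f i x)) = f j (f i (f j x))) :
    M.IsLiftable (G := Function.End X) f :=
  hM.isLiftable (G := Function.End X) f (fun i => funext (h1 i))
    (fun i j h => funext (h2 i j h)) (fun i j h => funext (h3 i j h))

open Classical in
/-- The action of a simple reflection on weights in the simply laced numbers game. -/
noncomputable def weightReflection (M : CoxeterMatrix I) (i : I) (v : I → ℤ) (k : I) : ℤ :=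
  if k = i then -v i else if M i k = 3 then v k + v i else v k

theorem CoxeterSystem.simple_injective_of_isSimplyLaced (cs : CoxeterSystem M W)
    (hM : M.IsSimplyLaced) : Function.Injective cs.simple := by
  classical
  have hl : M.IsLiftable (G := Function.End (I → ℤ)) (weightReflection M) := by
    refine hM.isLiftable_end _ (fun i v => funext fun k => ?_)
      (fun i j h v => funext fun k => ?_) (fun i j h v => funext fun k => ?_)
    · simp only [weightReflection]
      split_ifs <;> simp_all
    · have hs : M j i = 2 := by rw [M.symmetric, h]
      have hne : i ≠ j := by rintro rfl; simp at h
      simp only [weightReflection]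
      split_ifs <;> simp_all
      ring
    · have hs : M j i = 3 := by rw [M.symmetric, h]
      have hne : i ≠ j := by rintro rfl; simp at h
      simp only [weightReflection]
      split_ifs <;> simp_all <;> ring
  intro i j hij
  by_contra hne
  have h := congrArg (fun x => cs.lift ⟨_, hl⟩ x (Pi.single i 1) i) hij
  simp only [cs.lift_apply_simple hl, weightReflection] at h
  simp [hne, Ne.symm hne] at h

open Classical in
/-- The action of a simple reflection on pairs (group element, sign): conjugation on the first
component, and a change of sign exactly at the reflection itself. -/
noncomputable def signedConj (cs : CoxeterSystem M W) (i : I) (p : W × ZMod 2) : W × ZMod 2 :=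
  (cs.simple i * p.1 * cs.simple i, p.2 + if p.1 = cs.simple i then 1 else 0)

theorem isLiftable_signedConj (cs : CoxeterSystem M W) (hM : M.IsSimplyLaced) :
    M.IsLiftable (G := Function.End (W × ZMod 2)) (signedConj cs) := by
  classical
  have key : ∀ (i : I) (x y : W),
      cs.simple i * x * cs.simple i = y ↔ x = cs.simple i * y * cs.simple i := by
    intro i x y
    constructor
    · rintro rfl; simp [mul_assoc]
    · rintro rfl; simp [mul_assoc]
  refine hM.isLiftable_end _ ?_ ?_ ?_
  · rintro i ⟨t, e⟩
    refine Prod.ext (by simp [signedConj, mul_assoc]) ?_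
    simp only [signedConj, key, cs.simple_mul_simple_self, one_mul]
    rw [add_assoc, CharTwo.add_self_eq_zero, add_zero]
  · rintro i j h ⟨t, e⟩
    have hc := cs.simple_comm h
    have h1 : cs.simple i * cs.simple j * cs.simple i = cs.simple j := by
      rw [hc, mul_assoc, cs.simple_mul_simple_self, mul_one]
    have h2 : cs.simple j * cs.simple i * cs.simple j = cs.simple i := by
      rw [← hc, mul_assoc, cs.simple_mul_simple_self, mul_one]
    refine Prod.ext ?_ (by simp only [signedConj, key, h1, h2]; ring)
    calc cs.simple i * (cs.simple j * t * cs.simple j) * cs.simple i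
        = (cs.simple i * cs.simple j) * t * (cs.simple j * cs.simple i) := by
          simp only [mul_assoc]
      _ = (cs.simple j * cs.simple i) * t * (cs.simple i * cs.simple j) := by rw [hc]
      _ = cs.simple j * (cs.simple i * t * cs.simple i) * cs.simple j := by simp only [mul_assoc]
  · rintro i j h ⟨t, e⟩
    have hc := cs.simple_braid h
    have h1 : cs.simple i * (cs.simple j * cs.simple i * cs.simple j) * cs.simple i
        = cs.simple j := by
      rw [← hc]; simp [mul_assoc]
    have h2 : cs.simple j * (cs.simple i * cs.simple j * cs.simple i) * cs.simple j
        = cs.simple i := by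
      rw [hc]; simp [mul_assoc]
    refine Prod.ext ?_ (by simp only [signedConj, key, h1, h2]; rw [hc]; ring)
    calc cs.simple i * (cs.simple j * (cs.simple i * t * cs.simple i) * cs.simple j) * cs.simple i
        = (cs.simple i * cs.simple j * cs.simple i) * t *
          (cs.simple i * cs.simple j * cs.simple i) := by simp only [mul_assoc]
      _ = cs.simple j * (cs.simple i * (cs.simple j * t * cs.simple j) * cs.simple i) *
          cs.simple j := by rw [hc]; simp only [mul_assoc]

/-- The action of `W` on pairs (group element, sign) extending `signedConj`. -/
noncomputable def signedConjHom (cs : CoxeterSystem M W) (hM : M.IsSimplyLaced) :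
    W →* Function.End (W × ZMod 2) :=
  cs.lift ⟨_, isLiftable_signedConj cs hM⟩

theorem signedConjHom_simple_mul (cs : CoxeterSystem M W) (hM : M.IsSimplyLaced) (i : I) (w : W)
    (p : W × ZMod 2) :
    signedConjHom cs hM (cs.simple i * w) p = signedConj cs i (signedConjHom cs hM w p) := by
  rw [map_mul, signedConjHom, cs.lift_apply_simple (isLiftable_signedConj cs hM)]
  rfl

theorem signedConjHom_fst (cs : CoxeterSystem M W) (hM : M.IsSimplyLaced) (w : W)
    (p : W × ZMod 2) : (signedConjHom cs hM w p).1 = w * p.1 * w⁻¹ := by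
  induction w using cs.simple_induction_left with
  | one => simp [Function.End.one_def]
  | mul_simple_left w i ih =>
    rw [signedConjHom_simple_mul]
    simp [signedConj, ih, mul_assoc]

open Classical in
theorem signedConjHom_simple_mul_snd (cs : CoxeterSystem M W) (hM : M.IsSimplyLaced) (i : I)
    (w : W) (p : W × ZMod 2) :
    (signedConjHom cs hM (cs.simple i * w) p).2 =
      (signedConjHom cs hM w p).2 + if w * p.1 * w⁻¹ = cs.simple i then 1 else 0 := by
  rw [signedConjHom_simple_mul, signedConj, signedConjHom_fst]

theorem exists_eraseIdx_of_signedConjHom_ne_zero (cs : CoxeterSystem M W) (hM : M.IsSimplyLaced)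
    (t : W) (ω : List I) (h : (signedConjHom cs hM (cs.wordProd ω) (t, 0)).2 ≠ 0) :
    ∃ j < ω.length, cs.wordProd ω * t = cs.wordProd (ω.eraseIdx j) := by
  induction ω with
  | nil => simp [Function.End.one_def] at h
  | cons i ω ih =>
    rw [cs.wordProd_cons, signedConjHom_simple_mul_snd] at h
    split_ifs at h with ht
    · refine ⟨0, by simp, ?_⟩
      rw [mul_inv_eq_iff_eq_mul] at ht
      rw [cs.wordProd_cons, mul_assoc, ht]
      simp
    · obtain ⟨j, hj, hj'⟩ := ih (by simpa using h)
      exact ⟨j + 1, by simpa using hj, by simp [cs.wordProd_cons, mul_assoc, hj']⟩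

/-- The exchange condition for simply laced Coxeter systems. -/
theorem CoxeterSystem.exists_eraseIdx_of_isLeftDescent (cs : CoxeterSystem M W)
    (hM : M.IsSimplyLaced) {i : I} {ω : List I} (h : cs.IsLeftDescent (cs.wordProd ω) i) :
    ∃ j < ω.length, cs.simple i * cs.wordProd ω = cs.wordProd (ω.eraseIdx j) := by
  set w := cs.wordProd ω with hw
  have ht : w * (w⁻¹ * cs.simple i * w) = cs.simple i * w := by group
  by_cases h0 : (signedConjHom cs hM w (w⁻¹ * cs.simple i * w, 0)).2 = 0
  · obtain ⟨η, hη, hη'⟩ := cs.exists_isReduced (cs.simple i * w)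
    obtain ⟨j, hj, hj'⟩ := exists_eraseIdx_of_signedConjHom_ne_zero cs hM
      (w⁻¹ * cs.simple i * w) η (by
        rw [← hη', signedConjHom_simple_mul_snd, h0, if_pos (by group)]
        simp)
    rw [← hη', mul_assoc, ht, cs.simple_mul_simple_cancel_left] at hj'
    have h1 := cs.length_wordProd_le (η.eraseIdx j)
    rw [← hj', List.length_eraseIdx_of_lt hj] at h1
    have h2 := hη.eq
    rw [← hη'] at h2
    unfold CoxeterSystem.IsLeftDescent at h
    omega
  · obtain ⟨j, hj, hj'⟩ := exists_eraseIdx_of_signedConjHom_ne_zero cs hM _ ω h0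
    exact ⟨j, hj, by rw [← hj', ← hw, ht]⟩

/-- A property of words that is preserved by the (simply laced) braid moves. -/
structure BraidInvariant (M : CoxeterMatrix I) (P : List I → Prop) : Prop where
  comm : ∀ i j, M i j = 2 → ∀ u v, P (u ++ i :: j :: v) → P (u ++ j :: i :: v)
  braid : ∀ i j, M i j = 3 → ∀ u v, P (u ++ i :: j :: i :: v) → P (u ++ j :: i :: j :: v)

theorem BraidInvariant.cons {P : List I → Prop} (hP : BraidInvariant M P) (i : I) :
    BraidInvariant M fun l => P (i :: l) :=
  ⟨fun a b h u v => hP.comm a b h (i :: u) v, fun a b h u v => hP.braid a b h (i :: u) v⟩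

theorem CoxeterSystem.IsReduced.of_cons {cs : CoxeterSystem M W} {i : I} {l : List I}
    (h : cs.IsReduced (i :: l)) : cs.IsReduced l := by
  simpa using h.drop 1

theorem CoxeterSystem.IsReduced.isLeftDescent_cons {cs : CoxeterSystem M W} {i : I} {l : List I}
    (h : cs.IsReduced (i :: l)) : cs.IsLeftDescent (cs.wordProd (i :: l)) i := by
  unfold CoxeterSystem.IsLeftDescent
  rw [h.eq, cs.wordProd_cons, cs.simple_mul_simple_cancel_left, h.of_cons.eq]
  simp

/-- Matsumoto's theorem for simply laced Coxeter systems: a property of words preserved by braid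
moves passes from one reduced word of an element to every other one. -/
theorem CoxeterSystem.matsumoto (cs : CoxeterSystem M W) (hM : M.IsSimplyLaced)
    {P : List I → Prop} (hP : BraidInvariant M P) {l l' : List I} (hl : cs.IsReduced l)
    (hl' : cs.IsReduced l') (h : cs.wordProd l = cs.wordProd l') (hPl : P l) : P l' := by
  obtain ⟨n, hn⟩ : ∃ n, l.length = n := ⟨_, rfl⟩
  induction n using Nat.strong_induction_on generalizing l l' P with
  | _ n ih =>
  have hlen : l.length = l'.length := by rw [← hl.eq, ← hl'.eq, h]
  have same : ∀ {Q : List I → Prop} (_ : BraidInvariant M Q) (i : I) (u u' : List I),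
      (i :: u).length = n → cs.IsReduced (i :: u) → cs.IsReduced (i :: u') →
      cs.wordProd (i :: u) = cs.wordProd (i :: u') → Q (i :: u) → Q (i :: u') := by
    intro Q hQ i u u' hlu hu hu' huu hQu
    refine ih u.length (by simp at hlu; omega) (hQ.cons i) hu.of_cons hu'.of_cons ?_ hQu rfl
    simpa [cs.wordProd_cons] using huu
  match l, l' with
  | [], [] => exact hPl
  | [], _ :: _ => simp at hlen
  | _ :: _, [] => simp at hlen
  | i :: u, j :: v =>
  by_cases hij : i = j
  · subst hij; exact same hP i u v hn hl hl' h hPl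
  have hsij : cs.simple i ≠ cs.simple j := (cs.simple_injective_of_isSimplyLaced hM).ne hij
  have hdj : cs.IsLeftDescent (cs.wordProd (i :: u)) j := h ▸ hl'.isLeftDescent_cons
  simp only [List.length_cons] at hn hlen
  obtain ⟨p, hp, hp'⟩ := cs.exists_eraseIdx_of_isLeftDescent hM hdj
  cases p with
  | zero =>
    exfalso; apply hsij
    simp only [cs.wordProd_cons, List.eraseIdx_cons_zero] at hp'
    rw [← mul_assoc, mul_eq_right] at hp'
    rw [eq_inv_of_mul_eq_one_left hp', cs.inv_simple]
  | succ p =>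
  simp only [List.eraseIdx_cons_succ, List.length_cons, add_lt_add_iff_right] at hp hp'
  have hw : cs.wordProd (i :: u) = cs.wordProd (j :: i :: u.eraseIdx p) := by
    rw [cs.wordProd_cons j, ← hp', cs.simple_mul_simple_cancel_left]
  have hul := List.length_eraseIdx_add_one hp
  generalize u.eraseIdx p = u' at hw hul
  have hred : cs.IsReduced (j :: i :: u') := by
    unfold CoxeterSystem.IsReduced
    rw [← hw, hl.eq]; simp [hul]
  rcases hM i j hij with hm | hm
  · have hw2 : cs.wordProd (i :: j :: u') = cs.wordProd (j :: i :: u') := by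
      simp only [cs.wordProd_cons, ← mul_assoc, cs.simple_comm hm]
    have hred2 : cs.IsReduced (i :: j :: u') := by
      unfold CoxeterSystem.IsReduced
      rw [hw2, hred.eq]; simp
    have h1 := same hP i u (j :: u') (by simpa) hl hred2 (hw.trans hw2.symm) hPl
    have h2 := hP.comm i j hm [] u' h1
    exact same hP j (i :: u') v (by simp; omega) hred hl' (hw.symm.trans h) h2
  · have hdi : cs.IsLeftDescent (cs.wordProd (j :: i :: u')) i := hw ▸ hl.isLeftDescent_cons
    obtain ⟨q, hq, hq'⟩ := cs.exists_eraseIdx_of_isLeftDescent hM hdi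
    match q with
    | 0 =>
      exfalso; apply hsij
      simp only [cs.wordProd_cons, List.eraseIdx_cons_zero] at hq'
      rw [← mul_assoc, mul_eq_right] at hq'
      rw [eq_inv_of_mul_eq_one_left hq', cs.inv_simple]
    | 1 =>
      exfalso; apply hsij
      simp only [cs.wordProd_cons, List.eraseIdx_cons_succ, List.eraseIdx_cons_zero] at hq'
      rw [← mul_assoc, ← mul_assoc, mul_left_inj] at hq'
      have hb := cs.simple_braid hm
      rw [hq', mul_assoc, eq_comm, mul_eq_left] at hb
      rw [eq_inv_of_mul_eq_one_left hb, cs.inv_simple]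
    | q + 2 =>
    simp only [List.eraseIdx_cons_succ, List.length_cons, add_lt_add_iff_right] at hq hq'
    have hul' := List.length_eraseIdx_add_one (show q < u'.length by omega)
    have hw3 : cs.wordProd (i :: u) = cs.wordProd (i :: j :: i :: u'.eraseIdx q) := by
      rw [cs.wordProd_cons i (j :: _), ← hq', cs.simple_mul_simple_cancel_left, hw]
    generalize u'.eraseIdx q = u'' at hw3 hul'
    have hw4 : cs.wordProd (i :: j :: i :: u'') = cs.wordProd (j :: i :: j :: u'') := by
      simp only [cs.wordProd_cons, ← mul_assoc, cs.simple_braid hm]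
    have hred3 : cs.IsReduced (i :: j :: i :: u'') := by
      unfold CoxeterSystem.IsReduced
      rw [← hw3, hl.eq]; simp; omega
    have hred4 : cs.IsReduced (j :: i :: j :: u'') := by
      unfold CoxeterSystem.IsReduced
      rw [← hw4, hred3.eq]; simp
    have h1 := same hP i u _ (by simpa) hl hred3 hw3 hPl
    have h2 := hP.braid i j hm [] u'' h1
    exact same hP j _ v (by simp; omega) hred4 hl' (hw4.symm.trans (hw3.symm.trans h)) h2

end CoxeterExchange

section HeckeMonoid

open scoped Pointwise

variable {I W : Type*} [Group W] {M : CoxeterMatrix I}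

/-- The homomorphism from the 0-Hecke monoid to subsets of the Coxeter group sending `g_i` to
`{1, s_i}`; it sends a product of generators to the set of all its subword products. -/
noncomputable def subwordProducts (cs : CoxeterSystem M W) : Hecke M →* Set W :=
  Con.lift (conGen (HeckeRel M)) (FreeMonoid.lift fun i => ({1, cs.simple i} : Set W)) <| by
    refine Con.conGen_le.2 fun x y h => ?_
    have mul_gen : ∀ (A : Set W) (i : I),
        A * {1, cs.simple i} = A ∪ Set.image (· * cs.simple i) A := by
      intro A i
      rw [Set.insert_eq, Set.mul_union, Set.mul_singleton, Set.mul_singleton]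
      simp
    have key : ∀ (i : I) (x y : W), x * cs.simple i = y ↔ x = y * cs.simple i := by
      intro i x y
      rw [← cs.inv_simple i, mul_inv_eq_iff_eq_mul, cs.inv_simple]
    rw [Con.ker_rel]
    cases h with
    | comm i j h =>
      have hc := cs.simple_comm h
      simp only [map_mul, FreeMonoid.lift_eval_of, mul_gen]
      ext x
      simp [key, hc]
      tauto
    | braid i j h =>
      have hc := cs.simple_braid h
      simp only [map_mul, FreeMonoid.lift_eval_of, mul_gen]
      ext x
      simp [key, hc]
      tauto
    | idem i =>
      simp only [map_mul, FreeMonoid.lift_eval_of, mul_gen]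
      ext x
      simp [key]
      tauto

theorem subwordProducts_genH (cs : CoxeterSystem M W) (i : I) :
    subwordProducts cs (genH M i) = {1, cs.simple i} := rfl

theorem prodH_cons (i : I) (l : List I) : prodH M (i :: l) = genH M i * prodH M l := by
  simp [prodH]

theorem wordProd_mem_subwordProducts (cs : CoxeterSystem M W) (l : List I) :
    cs.wordProd l ∈ subwordProducts cs (prodH M l) := by
  induction l with
  | nil => simp [prodH]
  | cons i l ih =>
    rw [prodH_cons, map_mul, subwordProducts_genH, cs.wordProd_cons]
    exact Set.mul_mem_mul (by simp) ih

theorem length_le_of_mem_subwordProducts (cs : CoxeterSystem M W) (l : List I) {w : W}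
    (hw : w ∈ subwordProducts cs (prodH M l)) : cs.length w ≤ l.length := by
  induction l generalizing w with
  | nil =>
    have : w = 1 := by simpa [prodH] using hw
    simp [this]
  | cons i l ih =>
    rw [prodH_cons, map_mul, subwordProducts_genH] at hw
    obtain ⟨a, ha, b, hb, rfl⟩ := Set.mem_mul.1 hw
    have hb' := ih hb
    have ha' : cs.length a ≤ 1 := by
      rcases ha with rfl | rfl <;> simp
    have := cs.length_mul_le a b
    simp only [List.length_cons]
    omega

/-- A reduced word has minimal length among the words with the same product in the 0-Hecke
monoid. -/
theorem CoxeterSystem.IsReduced.length_le_of_prodH_eq {cs : CoxeterSystem M W} {l l' : List I}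
    (hl : cs.IsReduced l) (h : prodH M l = prodH M l') : l.length ≤ l'.length := by
  rw [← hl.eq]
  exact length_le_of_mem_subwordProducts cs l' (h ▸ wordProd_mem_subwordProducts cs l)

end HeckeMonoid

section ZeroSubword

variable {I W : Type*} [Group W] {M : CoxeterMatrix I} {K : AddSubgroup ℝ}

theorem coe_kmin (a b : K) : ((kmin a b : K) : ℝ) = min (a : ℝ) b := by
  unfold kmin
  split_ifs with h
  · rw [min_eq_left h]
  · rw [min_eq_right (le_of_not_ge h)]

theorem genH_comm {i j : I} (h : M i j = 2) : genH M i * genH M j = genH M j * genH M i :=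
  Quotient.sound (ConGen.Rel.of _ _ (HeckeRel.comm i j h))

theorem genH_braid {i j : I} (h : M i j = 3) :
    genH M i * genH M j * genH M i = genH M j * genH M i * genH M j :=
  Quotient.sound (ConGen.Rel.of _ _ (HeckeRel.braid i j h))

theorem genH_idem (i : I) : genH M i * genH M i = genH M i :=
  Quotient.sound (ConGen.Rel.of _ _ (HeckeRel.idem i))

theorem genU_comm {i j : I} (h : M i j = 2) (a b : K) :
    genU M K i a * genU M K j b = genU M K j b * genU M K i a :=
  Quotient.sound (ConGen.Rel.of _ _ (UKRel.comm i j h a b))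

theorem genU_braid {i j : I} (h : M i j = 3) (a b c : K) :
    genU M K i a * genU M K j b * genU M K i c =
      genU M K j (b + c - kmin a c) * genU M K i (kmin a c) * genU M K j (a + b - kmin a c) :=
  Quotient.sound (ConGen.Rel.of _ _ (UKRel.braid i j h a b c))

open Classical in
/-- The value of the zero-subword map on a generator: `g_i` if the exponent vanishes, `1` if it is
positive, and the absorbing element `0` if it is negative. -/
noncomputable def zeroSubwordGen (M : CoxeterMatrix I) (i : I) (x : ℝ) : WithZero (Hecke M) :=
  if x < 0 then 0 else if x = 0 then (genH M i : Hecke M) else 1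

theorem zeroSubwordGen_of_neg (i : I) {x : ℝ} (hx : x < 0) : zeroSubwordGen M i x = 0 :=
  if_pos hx

theorem zeroSubwordGen_zero (i : I) : zeroSubwordGen M i 0 = (genH M i : Hecke M) := by
  simp [zeroSubwordGen]

theorem zeroSubwordGen_of_pos (i : I) {x : ℝ} (hx : 0 < x) : zeroSubwordGen M i x = 1 := by
  simp [zeroSubwordGen, hx.not_gt, hx.ne']

theorem zeroSubwordGen_comm {i j : I} (h : M i j = 2) (a b : ℝ) :
    zeroSubwordGen M i a * zeroSubwordGen M j b = zeroSubwordGen M j b * zeroSubwordGen M i a := by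
  unfold zeroSubwordGen
  split_ifs <;> simp [← WithZero.coe_mul, genH_comm h]

theorem zeroSubwordGen_braid_add {i j : I} (h : M i j = 3) (a b : ℝ) {d : ℝ} (hd : 0 ≤ d) :
    zeroSubwordGen M i a * zeroSubwordGen M j b * zeroSubwordGen M i (a + d) =
      zeroSubwordGen M j (b + d) * zeroSubwordGen M i a * zeroSubwordGen M j b := by
  rcases lt_trichotomy a 0 with ha | rfl | ha
  · simp [zeroSubwordGen_of_neg _ ha]
  all_goals rcases lt_trichotomy b 0 with hb | rfl | hb
  all_goals first
    | simp [zeroSubwordGen_of_neg _ hb]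
    | rcases hd.eq_or_lt with rfl | hd'
  · simp [zeroSubwordGen_zero, ← WithZero.coe_mul, genH_braid h]
  · simp [zeroSubwordGen_zero, zeroSubwordGen_of_pos _ hd']
  · simp [zeroSubwordGen_zero, zeroSubwordGen_of_pos _ hb, ← WithZero.coe_mul, genH_idem]
  · simp [zeroSubwordGen_of_pos, hb, hd', add_pos]
  · simp [zeroSubwordGen_zero, zeroSubwordGen_of_pos _ ha, ← WithZero.coe_mul, genH_idem]
  · simp [zeroSubwordGen_of_pos, ha, hd', add_pos]
  · simp [zeroSubwordGen_of_pos, ha, hb]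
  · simp [zeroSubwordGen_of_pos, ha, hb, hd', add_pos]

theorem zeroSubwordGen_braid {i j : I} (h : M i j = 3) (a b c : ℝ) :
    zeroSubwordGen M i a * zeroSubwordGen M j b * zeroSubwordGen M i c =
      zeroSubwordGen M j (b + c - min a c) * zeroSubwordGen M i (min a c) *
        zeroSubwordGen M j (a + b - min a c) := by
  rcases le_total a c with hac | hac
  · obtain ⟨d, hd, rfl⟩ : ∃ d, 0 ≤ d ∧ c = a + d := ⟨c - a, by linarith, by ring⟩
    rw [min_eq_left hac, zeroSubwordGen_braid_add h a b hd]
    ring_nf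
  · obtain ⟨d, hd, rfl⟩ : ∃ d, 0 ≤ d ∧ a = c + d := ⟨a - c, by linarith, by ring⟩
    rw [min_eq_right hac, ← zeroSubwordGen_braid_add (by rw [M.symmetric, h]) b c hd]
    ring_nf

theorem zeroSubwordGen_idem (i : I) (a b : ℝ) :
    zeroSubwordGen M i a * zeroSubwordGen M i b = zeroSubwordGen M i (min a b) := by
  rcases lt_trichotomy a 0 with ha | rfl | ha
  · simp [zeroSubwordGen_of_neg, ha]
  all_goals rcases lt_trichotomy b 0 with hb | rfl | hb
  · simp [zeroSubwordGen_of_neg, hb]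
  · simp [zeroSubwordGen_zero, ← WithZero.coe_mul, genH_idem]
  · simp [zeroSubwordGen_of_pos, hb, hb.le]
  · simp [zeroSubwordGen_of_neg, hb]
  · simp [zeroSubwordGen_of_pos, ha, ha.le]
  · simp [zeroSubwordGen_of_pos, ha, hb]

/-- The zero-subword map on all of `𝔘(K)`. -/
noncomputable def zeroSubword (M : CoxeterMatrix I) (K : AddSubgroup ℝ) :
    UK M K →* WithZero (Hecke M) :=
  Con.lift (conGen (UKRel M K)) (FreeMonoid.lift fun p => zeroSubwordGen M p.1 p.2) <| by
    refine Con.conGen_le.2 fun x y h => ?_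
    rw [Con.ker_rel]
    cases h with
    | comm i j h a b => simpa using zeroSubwordGen_comm h a b
    | braid i j h a b c => simpa [coe_kmin] using zeroSubwordGen_braid h a b c
    | idem i a b => simpa [coe_kmin] using zeroSubwordGen_idem i a b

theorem zeroSubword_genU (i : I) (a : K) :
    zeroSubword M K (genU M K i a) = zeroSubwordGen M i a := rfl

theorem prodU_cons (p : I × K) (ω : List (I × K)) :
    prodU M K (p :: ω) = genU M K p.1 p.2 * prodU M K ω := by
  simp [prodU]

theorem prodU_append (ω ω' : List (I × K)) :
    prodU M K (ω ++ ω') = prodU M K ω * prodU M K ω' := by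
  simp [prodU]

/-- On words with nonnegative exponents, `zeroSubword` computes the zero-subword; in particular
the zero-subword does not depend on the chosen word. -/
theorem zeroSubword_prodU {ω : List (I × K)} (hω : ∀ p ∈ ω, 0 ≤ (p.2 : ℝ)) :
    zeroSubword M K (prodU M K ω) = (chiRep M ω : Hecke M) := by
  induction ω with
  | nil => simp [prodU, chiRep, zeroList, prodH]
  | cons p ω ih =>
    rw [prodU_cons, map_mul, ih fun q hq => hω q (List.mem_cons_of_mem p hq), zeroSubword_genU]
    rcases (hω p List.mem_cons_self).eq_or_lt with hp | hp
    · rw [← hp, zeroSubwordGen_zero]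
      simp [chiRep, zeroList, ← hp, prodH]
    · rw [zeroSubwordGen_of_pos _ hp]
      simp [chiRep, zeroList, hp.ne']

theorem zeroList_length_le (ω : List (I × K)) : (zeroList ω).length ≤ ω.length := by
  induction ω with
  | nil => simp [zeroList]
  | cons p ω ih =>
    unfold zeroList
    split_ifs <;> simp <;> omega

theorem eq_map_zero_of_length_le_zeroList {ω : List (I × K)}
    (h : ω.length ≤ (zeroList ω).length) : ω = (ω.map Prod.fst).map fun i => (i, (0 : K)) := by
  induction ω with
  | nil => simp
  | cons p ω ih =>
    unfold zeroList at h
    split_ifs at h with hp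
    · simp only [List.length_cons, add_le_add_iff_right] at h
      simp only [List.map_cons]
      rw [← ih h]
      congr 1
      exact Prod.ext rfl (Subtype.ext hp)
    · have := zeroList_length_le ω
      simp at h
      omega

theorem braidInvariant_prodU_nonneg (u : UK M K) :
    BraidInvariant M fun l => ∃ ω : List (I × K), ω.map Prod.fst = l ∧
      (∀ p ∈ ω, 0 ≤ (p.2 : ℝ)) ∧ u = prodU M K ω := by
  constructor
  · rintro i j h x y ⟨ω, hω, hpos, rfl⟩
    obtain ⟨ω₁, ω', rfl, rfl, hω'⟩ := List.map_eq_append_iff.1 hω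
    obtain ⟨⟨i', a⟩, ω', rfl, rfl, hω''⟩ := List.map_eq_cons_iff.1 hω'
    obtain ⟨⟨j', b⟩, ω₂, rfl, rfl, rfl⟩ := List.map_eq_cons_iff.1 hω''
    refine ⟨ω₁ ++ (j', b) :: (i', a) :: ω₂, by simp, fun p hp => hpos p ?_, ?_⟩
    · simp only [List.mem_append, List.mem_cons] at hp ⊢
      tauto
    · simp only [prodU_append, prodU_cons]
      rw [← mul_assoc (genU M K _ a), genU_comm h, mul_assoc]
  · rintro i j h x y ⟨ω, hω, hpos, rfl⟩
    obtain ⟨ω₁, ω', rfl, rfl, hω'⟩ := List.map_eq_append_iff.1 hω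
    obtain ⟨⟨i', a⟩, ω', rfl, rfl, hω''⟩ := List.map_eq_cons_iff.1 hω'
    obtain ⟨⟨j', b⟩, ω', rfl, rfl, hω₃⟩ := List.map_eq_cons_iff.1 hω''
    obtain ⟨⟨k, c⟩, ω₂, rfl, hk, rfl⟩ := List.map_eq_cons_iff.1 hω₃
    dsimp only at hk h
    subst hk
    refine ⟨ω₁ ++ (j', b + c - kmin a c) :: (k, kmin a c) :: (j', a + b - kmin a c) :: ω₂,
      by simp, ?_, ?_⟩
    · simp only [List.mem_append, List.mem_cons, or_imp, forall_and, forall_eq] at hpos ⊢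
      obtain ⟨h₁, ha, hb, hc, h₂⟩ := hpos
      refine ⟨h₁, ?_, ?_, ?_, h₂⟩
      · push_cast [coe_kmin]
        linarith [min_le_right (a : ℝ) c]
      · rw [coe_kmin]
        exact le_min ha hc
      · push_cast [coe_kmin]
        linarith [min_le_left (a : ℝ) c]
    · simp only [prodU_append, prodU_cons]
      have hb := congrArg (· * prodU M K ω₂) (genU_braid h a b c)
      simp only [mul_assoc] at hb
      rw [hb]

theorem isRedWord_iff {cs : CoxeterSystem M W} {w : W} {l : List I} :
    IsRedWord cs w l ↔ cs.wordProd l = w ∧ cs.IsReduced l := by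
  unfold IsRedWord CoxeterSystem.IsReduced
  constructor
  · rintro ⟨rfl, h⟩; exact ⟨rfl, h.symm⟩
  · rintro ⟨rfl, h⟩; exact ⟨rfl, h.symm⟩

/-- Every element of `𝒰(K₊)` has a representation along any given reduced word of `w₀`. -/
theorem exists_prodU_eq_of_isRedWord {cs : CoxeterSystem M W} (hM : M.IsSimplyLaced) {w₀ : W}
    {u : UK M K} (hu : u ∈ calUplus M K cs w₀) {l : List I} (hl : IsRedWord cs w₀ l) :
    ∃ ω : List (I × K), ω.map Prod.fst = l ∧ (∀ p ∈ ω, 0 ≤ (p.2 : ℝ)) ∧ u = prodU M K ω := by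
  obtain ⟨ω, hω, hpos, rfl⟩ := hu
  rw [isRedWord_iff] at hω hl
  exact cs.matsumoto hM (braidInvariant_prodU_nonneg (prodU M K ω)) hω.2 hl.2
    (hω.1.trans hl.1.symm) ⟨ω, rfl, hpos, rfl⟩

theorem exists_isRedWord_cons {cs : CoxeterSystem M W} {w₀ : W}
    (hw₀ : ∀ w, cs.length w ≤ cs.length w₀) (i : I) : ∃ l, IsRedWord cs w₀ (i :: l) := by
  obtain ⟨l, hl, hl'⟩ := cs.exists_isReduced (cs.simple i * w₀)
  have hd : cs.length (cs.simple i * w₀) + 1 = cs.length w₀ := by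
    rcases cs.length_simple_mul w₀ i with h | h
    · have := hw₀ (cs.simple i * w₀)
      omega
    · exact h
  refine ⟨l, by rw [cs.wordProd_cons, ← hl', cs.simple_mul_simple_cancel_left], ?_⟩
  rw [List.length_cons, ← hl.eq, ← hl', hd]

/-- Every element of `𝒰(K₊)` has a representation beginning with any given letter. -/
theorem exists_eq_genU_mul_prodU {cs : CoxeterSystem M W} (hM : M.IsSimplyLaced) {w₀ : W}
    (hw₀ : ∀ w, cs.length w ≤ cs.length w₀) {u : UK M K} (hu : u ∈ calUplus M K cs w₀) (i : I) :
    ∃ (c : K) (ω : List (I × K)), 0 ≤ (c : ℝ) ∧ (∀ p ∈ ω, 0 ≤ (p.2 : ℝ)) ∧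
      IsRedWord cs w₀ (i :: ω.map Prod.fst) ∧ u = genU M K i c * prodU M K ω := by
  obtain ⟨l, hl⟩ := exists_isRedWord_cons hw₀ i
  obtain ⟨ω', hω', hpos, rfl⟩ := exists_prodU_eq_of_isRedWord hM hu hl
  obtain ⟨⟨_, c⟩, ω, rfl, rfl, rfl⟩ := List.map_eq_cons_iff.1 hω'
  simp only [List.mem_cons, forall_eq_or_imp] at hpos
  exact ⟨c, ω, hpos.1, hpos.2, hl, prodU_cons _ _⟩

theorem genU_zero_mul_prodU_mem_calUplus {cs : CoxeterSystem M W} {w₀ : W} {i : I}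
    {ω : List (I × K)} (hω : ∀ p ∈ ω, 0 ≤ (p.2 : ℝ)) (h : IsRedWord cs w₀ (i :: ω.map Prod.fst)) :
    genU M K i 0 * prodU M K ω ∈ calUplus M K cs w₀ :=
  ⟨(i, 0) :: ω, h, by simpa using hω, (prodU_cons (i, (0 : K)) ω).symm⟩

/-- If the zero-subword of `i^c ⋯` is the product along a word `l` such that `i :: l` is reduced,
then `c` is positive. -/
theorem pos_of_zeroSubword_genU_mul {cs : CoxeterSystem M W} {i : I} {l : List I}
    (hl : cs.IsReduced (i :: l)) {c : K} (hc : 0 ≤ (c : ℝ)) {u : UK M K}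
    (h : zeroSubword M K (genU M K i c * u) = (prodH M l : Hecke M)) : 0 < (c : ℝ) := by
  refine hc.lt_of_ne fun h0 => ?_
  rw [map_mul, zeroSubword_genU, ← h0, zeroSubwordGen_zero] at h
  have h1 : prodH M (i :: l) = prodH M l := by
    rw [← WithZero.coe_inj, prodH_cons, WithZero.coe_mul, ← h, ← mul_assoc, ← WithZero.coe_mul,
      genH_idem]
  have := hl.length_le_of_prodH_eq h1
  simp at this

/-- An element of `𝒰(K₊)` whose zero-subword is reduced of maximal length is the product of the
generators with all exponents zero along any reduced word of `w₀`. -/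
theorem eq_prodU_zero_of_zeroSubword_eq {cs : CoxeterSystem M W} (hM : M.IsSimplyLaced) {w₀ : W}
    {u : UK M K} (hu : u ∈ calUplus M K cs w₀) {l l' : List I} (hl : IsRedWord cs w₀ l)
    (hl' : cs.IsReduced l') (hlen : l'.length = l.length)
    (h : zeroSubword M K u = (prodH M l' : Hecke M)) :
    u = prodU M K (l.map fun i => (i, (0 : K))) := by
  obtain ⟨ω, hω, hpos, rfl⟩ := exists_prodU_eq_of_isRedWord hM hu hl
  rw [zeroSubword_prodU hpos, WithZero.coe_inj] at h
  have h1 := hl'.length_le_of_prodH_eq h.symm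
  rw [← hω]
  congr 1
  refine eq_map_zero_of_length_le_zeroList ?_
  rw [← hω, List.length_map] at hlen
  omega

end ZeroSubword

/-- **No. 12** (Lusztig, "Half circles on flag manifolds over a semifield").
Let `(i₁, …, i_ν)` be a reduced word of `w₀` and let `H ∈ 𝒰(K₊)` satisfy
`χ_{w₀}(H) = 1` in `𝔘₁`.  Then there is a descent chain `H = H₁, …, H_{ν+1}` for `H`
along `(i₁, …, i_ν)` with tuple `(c₁, …, c_ν) ∈ K₊^ν` such that
`H_{ν+1} = i₁^0 ⋯ i_ν^0`, and moreover `c_k > 0` and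
`χ_{w₀}(H_{k+1}) = g_{i_k} g_{i_{k-1}} ⋯ g_{i₁}` for every `k ∈ {1, …, ν}`. -/
theorem descentChain_of_chi_one
    {I W : Type*} [Finite I] [Nonempty I] [Group W] [Finite W]
    (M : CoxeterMatrix I) (hM : ∀ i j : I, i ≠ j → M i j = 2 ∨ M i j = 3)
    (cs : CoxeterSystem M W)
    (K : AddSubgroup ℝ) (hK : K ≠ ⊥)
    (ν : ℕ) (w₀ : W) (hw₀ : cs.length w₀ = ν) (hν : ∀ w : W, cs.length w ≤ ν)
    (l : List I) (hl : IsRedWord cs w₀ l)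
    (H : UK M K) (hH : H ∈ calUplus M K cs w₀)
    (hchi : ∀ ω : List (I × K), IsRedWord cs w₀ (ω.map Prod.fst) →
      (∀ p ∈ ω, 0 ≤ (p.2 : ℝ)) → H = prodU M K ω → chiRep M ω = 1) :
    ∃ (Hs : ℕ → UK M K) (c : ℕ → K),
      DescentChain M K cs w₀ l H Hs c ∧
      Hs l.length = prodU M K (l.map fun i => (i, (0 : K))) ∧
      ∀ k < l.length, 0 < (c k : ℝ) ∧
        ∀ ω : List (I × K), IsRedWord cs w₀ (ω.map Prod.fst) →
          (∀ p ∈ ω, 0 ≤ (p.2 : ℝ)) → Hs (k + 1) = prodU M K ω →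
          chiRep M ω = prodH M ((l.take (k + 1)).reverse) := by
  have hM' : M.IsSimplyLaced := hM
  have hmax : ∀ w, cs.length w ≤ cs.length w₀ := fun w => hw₀ ▸ hν w
  choose C ω hC hω hred heq using fun (u : calUplus M K cs w₀) (i : I) =>
    exists_eq_genU_mul_prodU hM' hmax u.2 i
  let next : calUplus M K cs w₀ → I → calUplus M K cs w₀ := fun u i =>
    ⟨genU M K i 0 * prodU M K (ω u i), genU_zero_mul_prodU_mem_calUplus (hω u i) (hred u i)⟩
  let U : ℕ → calUplus M K cs w₀ := fun k => (l.take k).foldl next ⟨H, hH⟩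
  have hU : ∀ k (hk : k < l.length), U (k + 1) = next (U k) l[k] := fun k hk => by
    simp only [U, List.take_succ_eq_append_getElem hk, List.foldl_append, List.foldl_cons,
      List.foldl_nil]
  have hlred := (isRedWord_iff.1 hl).2
  have htake : ∀ k (hk : k < l.length),
      (l.take (k + 1)).reverse = l[k] :: (l.take k).reverse := fun k hk => by
    rw [List.take_succ_eq_append_getElem hk, List.reverse_append]
    rfl
  have hstep : ∀ k (hk : k < l.length),
      zeroSubword M K (U k) = (prodH M (l.take k).reverse : Hecke M) →
      0 < (C (U k) l[k] : ℝ) ∧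
        zeroSubword M K (U (k + 1)) = (prodH M (l.take (k + 1)).reverse : Hecke M) := by
    intro k hk h
    have hr : cs.IsReduced (l[k] :: (l.take k).reverse) :=
      htake k hk ▸ (hlred.take (k + 1)).reverse
    rw [heq (U k) l[k]] at h
    have hpos := pos_of_zeroSubword_genU_mul hr (hC _ _) h
    refine ⟨hpos, ?_⟩
    rw [map_mul, zeroSubword_genU, zeroSubwordGen_of_pos _ hpos, one_mul] at h
    rw [hU k hk, htake k hk, prodH_cons, WithZero.coe_mul, ← h, map_mul, zeroSubword_genU]
    rw [ZeroMemClass.coe_zero, zeroSubwordGen_zero]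
  have hz : ∀ k ≤ l.length, zeroSubword M K (U k) = (prodH M (l.take k).reverse : Hecke M) := by
    intro k
    induction k with
    | zero =>
      intro _
      obtain ⟨η, hη, hpos, hHη⟩ := hH
      change zeroSubword M K H = _
      have h1 := hchi η hη hpos hHη
      rw [hHη, zeroSubword_prodU hpos, h1]
      simp [prodH]
    | succ k ih => exact fun hk => (hstep k hk (ih (by omega))).2
  refine ⟨fun k => U k, fun k => if hk : k < l.length then C (U k) l[k] else 0,
    ⟨rfl, fun k _ => (U k).2, fun k hk => ?_, fun k hk => ⟨ω (U k) l[k], hω _ _, hred _ _, ?_, ?_⟩⟩,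
    ?_, fun k hk => ⟨?_, fun η _ hpos hη => ?_⟩⟩
  · simp only [dif_pos hk]
    exact hC _ _
  · simp only [dif_pos hk]
    exact heq _ _
  · exact congrArg Subtype.val (hU k hk)
  · refine eq_prodU_zero_of_zeroSubword_eq hM' (U l.length).2 hl hlred.reverse (by simp) ?_
    simpa using hz l.length le_rfl
  · simp only [dif_pos hk]
    exact (hstep k hk (hz k hk.le)).1
  · rw [← WithZero.coe_inj, ← zeroSubword_prodU hpos, ← hη]
    exact hz (k + 1) hk
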